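/- arXiv:math/0012209 — 2 statements merged into one kernel-verified Lean document; each statement's English description precedes it below -/
import Mathlib

section
/- Suppose Assumption A holds and τ ∈ (0,1). Then there exists δ > 0 such that for all (z,λ) with δ(z,λ) ≤ δ, the estimated active set satisfies A(z,λ) = B. -/
open scoped RealInnerProductSpace
open Metric Set

noncomputable section

/-- Euclidean space ℝ^n. -/
abbrev En (n : ℕ) := EuclideanSpace ℝ (Fin n)

/-- The Lagrangian L(z,λ) = φ(z) + λᵀ g(z). -/
def Lagr {n m : ℕ} (φ : En n → ℝ) (g : Fin m → En n → ℝ) (z : En n) (l : En m) : ℝ :=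
  φ z + ∑ i, l i * g i z

/-- ∇_z L(z,λ). -/
def gradL {n m : ℕ} (φ : En n → ℝ) (g : Fin m → En n → ℝ) (l : En m) (z : En n) : En n :=
  gradient (fun z' => Lagr φ g z' l) z

/-- ∇²_{zz} L(z,λ), as a continuous linear map. -/
def hessL {n m : ℕ} (φ : En n → ℝ) (g : Fin m → En n → ℝ) (l : En m) (z : En n) :
    En n →L[ℝ] En n :=
  fderiv ℝ (gradL φ g l) z

/-- The KKT conditions at a point z with multiplier λ. -/
def KKTat {n m : ℕ} (φ : En n → ℝ) (g : Fin m → En n → ℝ) (z : En n) (l : En m) : Prop :=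
  gradL φ g l z = 0 ∧ (∀ i, g i z ≤ 0) ∧ (∀ i, 0 ≤ l i) ∧ ∑ i, l i * g i z = 0

/-- The set S_λ of optimal multipliers at z*. -/
def Slam {n m : ℕ} (φ : En n → ℝ) (g : Fin m → En n → ℝ) (zs : En n) : Set (En m) :=
  {l | KKTat φ g zs l}

/-- The active set B. -/
def ActB {n m : ℕ} (g : Fin m → En n → ℝ) (zs : En n) : Set (Fin m) := {i | g i zs = 0}

/-- Strongly active constraints B₊. -/
def Bplus {n m : ℕ} (φ : En n → ℝ) (g : Fin m → En n → ℝ) (zs : En n) : Set (Fin m) :=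
  {i | g i zs = 0 ∧ ∃ l ∈ Slam φ g zs, 0 < l i}

/-- Weakly active constraints B₀ = B \ B₊. -/
def Bzero {n m : ℕ} (φ : En n → ℝ) (g : Fin m → En n → ℝ) (zs : En n) : Set (Fin m) :=
  ActB g zs \ Bplus φ g zs

/-- Mangasarian–Fromovitz constraint qualification at z*. -/
def MFCQ {n m : ℕ} (g : Fin m → En n → ℝ) (zs : En n) : Prop :=
  ∃ y : En n, ∀ i ∈ ActB g zs, ⟪gradient (g i) zs, y⟫ < 0

/-- The second-order sufficient condition. -/
def SOC {n m : ℕ} (φ : En n → ℝ) (g : Fin m → En n → ℝ) (zs : En n) : Prop :=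
  ∃ σ : ℝ, 0 < σ ∧ ∀ l ∈ Slam φ g zs, ∀ w : En n,
    (∀ i ∈ Bplus φ g zs, ⟪gradient (g i) zs, w⟫ = 0) →
    (∀ i ∈ Bzero φ g zs, ⟪gradient (g i) zs, w⟫ ≤ 0) →
    σ * ‖w‖ ^ 2 ≤ ⟪w, hessL φ g l zs w⟫

/-- φ and g twice Lipschitz continuously differentiable near z*. -/
def Smooth2 {n m : ℕ} (φ : En n → ℝ) (g : Fin m → En n → ℝ) (zs : En n) : Prop :=
  ∃ U ∈ nhds zs, ContDiffOn ℝ 2 φ U ∧ (∀ i, ContDiffOn ℝ 2 (g i) U) ∧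
    ∃ K : NNReal, LipschitzOnWith K (fun z => fderiv ℝ (fderiv ℝ φ) z) U ∧
      ∀ i, LipschitzOnWith K (fun z => fderiv ℝ (fderiv ℝ (g i)) z) U

/-- Assumption A: smoothness, KKT, MFCQ and the second-order condition hold at z*. -/
def AssumpA {n m : ℕ} (φ : En n → ℝ) (g : Fin m → En n → ℝ) (zs : En n) : Prop :=
  Smooth2 φ g zs ∧ (∃ l : En m, KKTat φ g zs l) ∧ MFCQ g zs ∧ SOC φ g zs

/-- δ(z,λ) = dist((z,λ), S) where S = {z*} × S_λ (Euclidean product norm). -/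
def deltaP {n m : ℕ} (φ : En n → ℝ) (g : Fin m → En n → ℝ) (zs : En n)
    (z : En n) (l : En m) : ℝ :=
  Real.sqrt (‖z - zs‖ ^ 2 + (Metric.infDist l (Slam φ g zs)) ^ 2)

/-- η(z,λ) = ‖(∇_z L(z,λ), min(λ, −g(z)))‖. -/
def eta {n m : ℕ} (φ : En n → ℝ) (g : Fin m → En n → ℝ) (z : En n) (l : En m) : ℝ :=
  Real.sqrt (‖gradL φ g l z‖ ^ 2 + ∑ i, (min (l i) (-(g i z))) ^ 2)

/-- The estimated active set A(z,λ) = {i : g_i(z) ≥ −η(z,λ)^τ}. -/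
def Aest {n m : ℕ} (φ : En n → ℝ) (g : Fin m → En n → ℝ) (τ : ℝ) (z : En n) (l : En m) :
    Set (Fin m) :=
  {i | -(eta φ g z l) ^ τ ≤ g i z}

/-- Feasibility for the linear program LP(Â) (independent of Â): componentwise bounds on
∇φ(z) + Σ_i λ̃_i ∇g_i(z), nonnegativity on A(z,λ), and λ̃_i = 0 off A(z,λ). -/
def LPFeasible {n m : ℕ} (φ : En n → ℝ) (g : Fin m → En n → ℝ) (τ : ℝ)
    (z : En n) (l : En m) (lt : En m) : Prop :=
  (∀ j : Fin n, |(gradient φ z + ∑ i, lt i • gradient (g i) z) j| ≤ (eta φ g z l) ^ τ) ∧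
  (∀ i ∈ Aest φ g τ z l, 0 ≤ lt i) ∧ (∀ i ∉ Aest φ g τ z l, lt i = 0)

/-- The objective Σ_{i ∈ Â} λ̃_i of LP(Â). -/
def lpObj {m : ℕ} (Ah : Set (Fin m)) (lt : En m) : ℝ :=
  ∑ i, Ah.indicator (fun i => lt i) i

/-- λ̃ is an optimal solution of LP(Â). -/
def LPOptimal {n m : ℕ} (φ : En n → ℝ) (g : Fin m → En n → ℝ) (τ : ℝ)
    (z : En n) (l : En m) (Ah : Set (Fin m)) (lt : En m) : Prop :=
  LPFeasible φ g τ z l lt ∧ ∀ lt', LPFeasible φ g τ z l lt' → lpObj Ah lt' ≤ lpObj Ah lt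

/-- The initial working set Â_init of Procedure ID0. -/
def initSet {n m : ℕ} (φ : En n → ℝ) (g : Fin m → En n → ℝ) (τ th : ℝ)
    (z : En n) (l : En m) : Set (Fin m) :=
  Aest φ g τ z l \ {i | (eta φ g z l) ^ th ≤ l i}

/-- One pass of the repeat loop of Procedure ID0 that does not stop:
an optimal solution λ̃ of LP(Â) is chosen, C = {i ∈ Â : λ̃_i ≥ η^τ̂} is nonempty,
and the working set is updated to Â \ C. -/
def ID0Step {n m : ℕ} (φ : En n → ℝ) (g : Fin m → En n → ℝ) (τ th : ℝ)
    (z : En n) (l : En m) (Ah Ah' : Set (Fin m)) : Prop :=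
  ∃ lt, LPOptimal φ g τ z l Ah lt ∧
    {i | i ∈ Ah ∧ (eta φ g z l) ^ th ≤ lt i} ≠ ∅ ∧
    Ah' = Ah \ {i | i ∈ Ah ∧ (eta φ g z l) ^ th ≤ lt i}

/-- (A₀, A₊) is a possible output of Procedure ID0 on input (z,λ). -/
def ID0Out {n m : ℕ} (φ : En n → ℝ) (g : Fin m → En n → ℝ) (τ th : ℝ)
    (z : En n) (l : En m) (A0 Ap : Set (Fin m)) : Prop :=
  ∃ Ah : Set (Fin m),
    Relation.ReflTransGen (ID0Step φ g τ th z l) (initSet φ g τ th z l) Ah ∧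
    ((∃ lt, LPOptimal φ g τ z l Ah lt ∧
        {i | i ∈ Ah ∧ (eta φ g z l) ^ th ≤ lt i} = ∅ ∧
        A0 = Ah ∧ Ap = Aest φ g τ z l \ Ah) ∨
     (∃ lt, LPOptimal φ g τ z l Ah lt ∧
        {i | i ∈ Ah ∧ (eta φ g z l) ^ th ≤ lt i} ≠ ∅ ∧
        Ah \ {i | i ∈ Ah ∧ (eta φ g z l) ^ th ≤ lt i} = ∅ ∧
        A0 = ∅ ∧ Ap = Aest φ g τ z l))

/-- Feasibility for the linear program (intlam). -/
def IntFeasible {n m : ℕ} (φ : En n → ℝ) (g : Fin m → En n → ℝ) (τ : ℝ)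
    (z : En n) (l : En m) (Ap : Set (Fin m)) (t : ℝ) (lh : En m) : Prop :=
  (∀ i ∈ Ap, t ≤ lh i) ∧
  (∀ j : Fin n, |(gradient φ z + ∑ i, lh i • gradient (g i) z) j| ≤ (eta φ g z l) ^ τ) ∧
  (∀ i ∈ Ap, 0 ≤ lh i) ∧ (∀ i ∉ Ap, lh i = 0)

/-- (t̂, λ̂) is an optimal solution of (intlam). -/
def IntOptimal {n m : ℕ} (φ : En n → ℝ) (g : Fin m → En n → ℝ) (τ : ℝ)
    (z : En n) (l : En m) (Ap : Set (Fin m)) (t : ℝ) (lh : En m) : Prop :=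
  IntFeasible φ g τ z l Ap t lh ∧
  ∀ t' lh', IntFeasible φ g τ z l Ap t' lh' → t' ≤ t

/-- ε_λ = max_{λ* ∈ S_λ} min_{i ∈ B₊} λ*_i. -/
def epsLam {n m : ℕ} (φ : En n → ℝ) (g : Fin m → En n → ℝ) (zs : En n) : ℝ :=
  ⨆ l ∈ Slam φ g zs, ⨅ i ∈ Bplus φ g zs, l i

/-- S_λ^ν = {λ ∈ S_λ : min_{i∈B₊} λ_i ≥ ν ε_λ}. -/
def SlamNu {n m : ℕ} (φ : En n → ℝ) (g : Fin m → En n → ℝ) (zs : En n) (ν : ℝ) :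
    Set (En m) :=
  {l ∈ Slam φ g zs | ∀ i ∈ Bplus φ g zs, ν * epsLam φ g zs ≤ l i}

/-- (Δz, λ⁺) solves the stabilized SQP subproblem at (z,λ) with parameter μ. -/
def SSQPSol {n m : ℕ} (φ : En n → ℝ) (g : Fin m → En n → ℝ)
    (z : En n) (l : En m) (μ : ℝ) (dz : En n) (lp : En m) : Prop :=
  hessL φ g l z dz + gradient φ z + ∑ i, lp i • gradient (g i) z = 0 ∧
  (∀ i, 0 ≤ lp i) ∧
  (∀ i, g i z + ⟪gradient (g i) z, dz⟫ - μ * (lp i - l i) ≤ 0) ∧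
  ∑ i, lp i * (g i z + ⟪gradient (g i) z, dz⟫ - μ * (lp i - l i)) = 0

/-- Euclidean distance between primal-dual pairs. -/
def pdist {n m : ℕ} (p q : En n × En m) : ℝ :=
  Real.sqrt (‖p.1 - q.1‖ ^ 2 + ‖p.2 - q.2‖ ^ 2)

open Filter Topology

section Derivatives

variable {n m : ℕ} {φ : En n → ℝ} {g : Fin m → En n → ℝ} {zs : En n}

lemma gradL_eq_of_differentiableAt {z : En n} (hφ : DifferentiableAt ℝ φ z)
    (hg : ∀ i, DifferentiableAt ℝ (g i) z) (l : En m) :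
    gradL φ g l z = gradient φ z + ∑ i, l i • gradient (g i) z := by
  have h : HasFDerivAt (fun z' => Lagr φ g z' l)
      (fderiv ℝ φ z + ∑ i, l i • fderiv ℝ (g i) z) z :=
    hφ.hasFDerivAt.add (HasFDerivAt.fun_sum fun i _ => (hg i).hasFDerivAt.const_mul (l i))
  simp [gradL, gradient, h.fderiv]

lemma ContDiffAt.eventually_differentiableAt_of_two {f : En n → ℝ} (hf : ContDiffAt ℝ 2 f zs) :
    ∀ᶠ z in 𝓝 zs, DifferentiableAt ℝ f z :=
  (hf.eventually (by simp)).mono fun _ hz => hz.differentiableAt (by simp)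

lemma ContDiffAt.differentiableAt_gradient {f : En n → ℝ} (hf : ContDiffAt ℝ 2 f zs) :
    DifferentiableAt ℝ (gradient f) zs := by
  have h : DifferentiableAt ℝ (fderiv ℝ f) zs :=
    (hf.fderiv_right (m := 1) (by norm_num)).differentiableAt (by simp)
  let e : (En n →L[ℝ] ℝ) →L[ℝ] En n :=
    { toFun := (InnerProductSpace.toDual ℝ (En n)).symm
      map_add' := map_add _
      map_smul' := fun c x => by simp
      cont := (InnerProductSpace.toDual ℝ (En n)).symm.continuous }
  exact e.differentiableAt.comp zs h

lemma eventually_gradL_eq (hφ : ContDiffAt ℝ 2 φ zs) (hg : ∀ i, ContDiffAt ℝ 2 (g i) zs) :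
    ∀ᶠ z in 𝓝 zs, ∀ l : En m,
      gradL φ g l z = gradient φ z + ∑ i, l i • gradient (g i) z := by
  filter_upwards [hφ.eventually_differentiableAt_of_two,
    eventually_all.2 fun i => (hg i).eventually_differentiableAt_of_two] with z h1 h2 l
  exact gradL_eq_of_differentiableAt h1 h2 l

lemma hessL_eq (hφ : ContDiffAt ℝ 2 φ zs) (hg : ∀ i, ContDiffAt ℝ 2 (g i) zs) (l : En m) :
    hessL φ g l zs =
      fderiv ℝ (gradient φ) zs + ∑ i, l i • fderiv ℝ (gradient (g i)) zs := by
  have h1 : gradL φ g l =ᶠ[𝓝 zs] fun z => gradient φ z + ∑ i, l i • gradient (g i) z :=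
    (eventually_gradL_eq hφ hg).mono fun z hz => hz l
  rw [hessL, h1.fderiv_eq]
  exact (hφ.differentiableAt_gradient.hasFDerivAt.add (HasFDerivAt.fun_sum fun i _ =>
    (hg i).differentiableAt_gradient.hasFDerivAt.const_smul (l i))).fderiv

lemma Smooth2.contDiffAt (h : Smooth2 φ g zs) :
    ContDiffAt ℝ 2 φ zs ∧ ∀ i, ContDiffAt ℝ 2 (g i) zs := by
  obtain ⟨U, hU, hφ, hg, -⟩ := h
  exact ⟨hφ.contDiffAt hU, fun i => (hg i).contDiffAt hU⟩

end Derivatives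

section Multipliers

variable {n m : ℕ} {φ : En n → ℝ} {g : Fin m → En n → ℝ} {zs : En n}

lemma KKTat.complementary {l : En m} (h : KKTat φ g zs l) (i : Fin m) : l i * g i zs = 0 := by
  obtain ⟨-, hg, hl, hs⟩ := h
  exact (Finset.sum_eq_zero_iff_of_nonpos fun i _ =>
    mul_nonpos_of_nonneg_of_nonpos (hl i) (hg i)).1 hs i (Finset.mem_univ i)

lemma KKTat.eq_zero_of_notMem {l : En m} (h : KKTat φ g zs l) {i : Fin m}
    (hi : i ∉ ActB g zs) : l i = 0 :=
  (mul_eq_zero.1 (h.complementary i)).resolve_right hi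

lemma KKTat.min_eq_zero {l : En m} (h : KKTat φ g zs l) (i : Fin m) :
    min (l i) (-(g i zs)) = 0 := by
  have h1 := h.2.1 i
  have h2 := h.2.2.1 i
  rcases mul_eq_zero.1 (h.complementary i) with h0 | h0
  · rw [h0]; exact min_eq_left (by linarith)
  · rw [h0]; simpa using h2

lemma KKTat.sum_mul_inner {l : En m} (h : KKTat φ g zs l) (hφ : ContDiffAt ℝ 2 φ zs)
    (hg : ∀ i, ContDiffAt ℝ 2 (g i) zs) (w : En n) :
    ∑ i, l i * ⟪gradient (g i) zs, w⟫ = -⟪gradient φ zs, w⟫ := by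
  have h0 := h.1
  rw [(eventually_gradL_eq hφ hg).self_of_nhds l] at h0
  have h1 := congrArg (fun v => ⟪v, w⟫) h0
  simp only [inner_add_left, sum_inner, real_inner_smul_left, inner_zero_left] at h1
  linarith

lemma isCompact_Slam (hφ : ContDiffAt ℝ 2 φ zs) (hg : ∀ i, ContDiffAt ℝ 2 (g i) zs)
    (hM : MFCQ g zs) : IsCompact (Slam φ g zs) := by
  have hgrad := (eventually_gradL_eq hφ hg).self_of_nhds
  refine Metric.isCompact_of_isClosed_isBounded ?_ ?_
  · have hS : Slam φ g zs =
        {l : En m | gradient φ zs + ∑ i, l i • gradient (g i) zs = 0} ∩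
          ({_l : En m | ∀ i, g i zs ≤ 0} ∩
            ((⋂ i, {l : En m | 0 ≤ l i}) ∩ {l : En m | ∑ i, l i * g i zs = 0})) := by
      ext l
      simp [Slam, KKTat, hgrad]
    rw [hS]
    refine (isClosed_eq (by fun_prop) (by fun_prop)).inter (isClosed_const.inter
      ((isClosed_iInter fun i => isClosed_le (by fun_prop) (by fun_prop)).inter
        (isClosed_eq (by fun_prop) (by fun_prop))))
  · obtain ⟨y, hy⟩ := hM
    have hbd : ∀ l ∈ Slam φ g zs, ∀ i,
        |l i| ≤ |⟪gradient φ zs, y⟫ / -⟪gradient (g i) zs, y⟫| := by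
      intro l hl i
      by_cases hi : i ∈ ActB g zs
      · have hneg : 0 < -⟪gradient (g i) zs, y⟫ := by linarith [hy i hi]
        have hsum := hl.sum_mul_inner hφ hg y
        have hle : l i * -⟪gradient (g i) zs, y⟫ ≤ ⟪gradient φ zs, y⟫ := by
          have := Finset.single_le_sum (f := fun i => l i * -⟪gradient (g i) zs, y⟫)
            (s := Finset.univ) (fun j _ => ?_) (Finset.mem_univ i)
          · simp only [mul_neg, Finset.sum_neg_distrib, hsum, neg_neg] at this ⊢
            exact this
          · by_cases hj : j ∈ ActB g zs
            · exact mul_nonneg (hl.2.2.1 j) (by linarith [hy j hj])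
            · simp [hl.eq_zero_of_notMem hj]
        rw [abs_of_nonneg (hl.2.2.1 i)]
        exact ((le_div_iff₀ hneg).2 hle).trans (le_abs_self _)
      · simp [hl.eq_zero_of_notMem hi]
    refine isBounded_iff_forall_norm_le.2
      ⟨√(∑ i, |⟪gradient φ zs, y⟫ / -⟪gradient (g i) zs, y⟫| ^ 2), fun l hl => ?_⟩
    rw [EuclideanSpace.norm_eq]
    refine Real.sqrt_le_sqrt (Finset.sum_le_sum fun i _ => ?_)
    rw [Real.norm_eq_abs]
    exact pow_le_pow_left₀ (abs_nonneg _) (hbd l hl i) 2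

end Multipliers

section ErrorBound

variable {n m : ℕ} {φ : En n → ℝ} {g : Fin m → En n → ℝ} {zs : En n}

lemma eta_nonneg (z : En n) (l : En m) : 0 ≤ eta φ g z l := Real.sqrt_nonneg _

lemma norm_gradL_le_eta (z : En n) (l : En m) : ‖gradL φ g l z‖ ≤ eta φ g z l :=
  Real.le_sqrt_of_sq_le (le_add_of_nonneg_right (Finset.sum_nonneg fun _ _ => sq_nonneg _))

lemma abs_min_le_eta (z : En n) (l : En m) (i : Fin m) :
    |min (l i) (-(g i z))| ≤ eta φ g z l := by
  refine Real.le_sqrt_of_sq_le ?_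
  rw [sq_abs]
  exact (Finset.single_le_sum (f := fun i => (min (l i) (-(g i z))) ^ 2)
    (fun _ _ => sq_nonneg _) (Finset.mem_univ i)).trans
    (le_add_of_nonneg_left (sq_nonneg _))

/-- The limit of a difference quotient along a filter on which the normalized increments
converge. -/
lemma HasFDerivAt.tendsto_quotient {α E F : Type*} [NormedAddCommGroup E] [NormedSpace ℝ E]
    [NormedAddCommGroup F] [NormedSpace ℝ F] {f : E → F} {f' : E →L[ℝ] F} {x w : E}
    (hf : HasFDerivAt f f' x) {𝒰 : Filter α} {z : α → E} {c : α → ℝ}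
    (hz : Tendsto z 𝒰 (𝓝 x)) (hw : Tendsto (fun a => c a • (z a - x)) 𝒰 (𝓝 w)) :
    Tendsto (fun a => c a • (f (z a) - f x)) 𝒰 (𝓝 (f' w)) := by
  have h0 : Tendsto (fun a => z a - x) 𝒰 (𝓝 0) := by
    simpa using hz.sub_const x
  simpa using hf.hasFDerivWithinAt.lim (s := univ) h0 (by simp) hw

variable {α : Type*} {𝒰 : Ultrafilter α} {z : α → En n} {l : α → En m} {ls : En m}

lemma tendsto_eta (hφ : ContDiffAt ℝ 2 φ zs) (hg : ∀ i, ContDiffAt ℝ 2 (g i) zs)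
    (hz : Tendsto z 𝒰 (𝓝 zs)) (hl : Tendsto l 𝒰 (𝓝 ls)) (hls : ls ∈ Slam φ g zs) :
    Tendsto (fun a => eta φ g (z a) (l a)) 𝒰 (𝓝 0) := by
  have hli : ∀ i, Tendsto (fun a => l a i) 𝒰 (𝓝 (ls i)) := fun i =>
    ((by fun_prop : Continuous fun x : En m => x i).tendsto ls).comp hl
  have h1 : Tendsto (fun a => gradL φ g (l a) (z a)) 𝒰 (𝓝 0) := by
    have h2 : Tendsto (fun a => gradient φ (z a) + ∑ i, l a i • gradient (g i) (z a)) 𝒰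
        (𝓝 (gradient φ zs + ∑ i, ls i • gradient (g i) zs)) :=
      (hφ.differentiableAt_gradient.continuousAt.tendsto.comp hz).add
        (tendsto_finsetSum _ fun i _ => (hli i).smul
          ((hg i).differentiableAt_gradient.continuousAt.tendsto.comp hz))
    rw [← (eventually_gradL_eq hφ hg).self_of_nhds ls, hls.1] at h2
    exact h2.congr' ((hz.eventually (eventually_gradL_eq hφ hg)).mono fun a ha => (ha _).symm)
  have h3 : ∀ i, Tendsto (fun a => min (l a i) (-(g i (z a)))) 𝒰 (𝓝 0) := fun i => by
    rw [← KKTat.min_eq_zero hls i]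
    exact (hli i).min ((hg i).continuousAt.tendsto.comp hz).neg
  have h4 := ((h1.norm.pow 2).add (tendsto_finsetSum Finset.univ fun i _ => (h3 i).pow 2)).sqrt
  simpa [eta] using h4

/-- Near the solution, the distance of the primal iterate to the solution cannot dominate the
KKT residual. -/
lemma not_eta_isLittleO (hφ : ContDiffAt ℝ 2 φ zs) (hg : ∀ i, ContDiffAt ℝ 2 (g i) zs)
    (hS : SOC φ g zs) (hz : Tendsto z 𝒰 (𝓝 zs)) (hl : Tendsto l 𝒰 (𝓝 ls))
    (hls : ls ∈ Slam φ g zs) (hne : ∀ᶠ a in 𝒰, z a ≠ zs) :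
    ¬ Tendsto (fun a => ‖z a - zs‖⁻¹ * eta φ g (z a) (l a)) 𝒰 (𝓝 0) := by
  intro ho
  set c : α → ℝ := fun a => ‖z a - zs‖⁻¹ with hc
  have hcpos : ∀ᶠ a in 𝒰, 0 < c a := hne.mono fun a ha =>
    inv_pos.2 (norm_pos_iff.2 (sub_ne_zero.2 ha))
  have hli : ∀ i, Tendsto (fun a => l a i) 𝒰 (𝓝 (ls i)) := fun i =>
    ((by fun_prop : Continuous fun x : En m => x i).tendsto ls).comp hl
  have hgi : ∀ i, Tendsto (fun a => g i (z a)) 𝒰 (𝓝 (g i zs)) := fun i =>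
    (hg i).continuousAt.tendsto.comp hz
  obtain ⟨w, hw1, hw⟩ : ∃ w : En n, ‖w‖ = 1 ∧ Tendsto (fun a => c a • (z a - zs)) 𝒰 (𝓝 w) := by
    obtain ⟨w, hw, hle⟩ := isCompact_iff_ultrafilter_le_nhds.1 (isCompact_sphere (0 : En n) 1)
      (𝒰.map fun a => c a • (z a - zs)) (by
        rw [Filter.le_principal_iff]
        refine hne.mono fun a ha => ?_
        have : ‖z a - zs‖ ≠ 0 := norm_ne_zero_iff.2 (sub_ne_zero.2 ha)
        simp [hc, norm_smul, this])
    exact ⟨w, by simpa using hw, hle⟩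
  set d : Fin m → ℝ := fun i => ⟪gradient (g i) zs, w⟫ with hd
  set r : Fin m → α → ℝ := fun i a => min (l a i) (-(g i (z a))) with hr
  have hrt : ∀ i, Tendsto (fun a => c a * r i a) 𝒰 (𝓝 0) := fun i => by
    refine squeeze_zero_norm' (hcpos.mono fun a ha => ?_) ho
    rw [Real.norm_eq_abs, abs_mul, abs_of_pos ha]
    exact mul_le_mul_of_nonneg_left (abs_min_le_eta _ _ i) ha.le
  have hr0 : ∀ i, Tendsto (r i) 𝒰 (𝓝 0) := fun i => by
    rw [← KKTat.min_eq_zero hls i]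
    exact (hli i).min (hgi i).neg
  have hgq : ∀ i ∈ ActB g zs, Tendsto (fun a => c a * g i (z a)) 𝒰 (𝓝 (d i)) := fun i hi => by
    have h := ((hg i).differentiableAt (by simp)).hasFDerivAt.tendsto_quotient hz hw
    have hi' : g i zs = 0 := hi
    simpa [hi', hd, inner_gradient_left] using h
  have hdnonpos : ∀ i ∈ ActB g zs, d i ≤ 0 := fun i hi => by
    have h := (hgq i hi).add (hrt i)
    rw [add_zero] at h
    refine le_of_tendsto h (hcpos.mono fun a ha => ?_)
    rw [← mul_add]
    refine mul_nonpos_of_nonneg_of_nonpos ha.le ?_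
    linarith [min_le_right (l a i) (-(g i (z a)))]
  have hd0 : ∀ i ∈ ActB g zs, (∀ᶠ a in 𝒰, r i a = -(g i (z a))) → d i = 0 := fun i hi h => by
    have h1 : Tendsto (fun a => c a * g i (z a)) 𝒰 (𝓝 0) := by
      have := (hrt i).neg
      rw [neg_zero] at this
      refine this.congr' (h.mono fun a ha => ?_)
      rw [ha]; ring
    exact tendsto_nhds_unique (hgq i hi) h1
  have hcases : ∀ i, (∀ᶠ a in 𝒰, r i a = l a i) ∨ (∀ᶠ a in 𝒰, r i a = -(g i (z a))) := fun i =>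
    Ultrafilter.eventually_or.1 (Eventually.of_forall fun a => min_choice _ _)
  have hlsz : ∀ i, (∀ᶠ a in 𝒰, r i a = l a i) → ls i = 0 := fun i h =>
    tendsto_nhds_unique ((hli i).congr' (h.mono fun a ha => ha.symm)) (hr0 i)
  have hlsd : ∀ i, ls i * d i = 0 := fun i => by
    by_cases hi : i ∈ ActB g zs
    · rcases hcases i with h | h
      · rw [hlsz i h, zero_mul]
      · rw [hd0 i hi h, mul_zero]
    · rw [KKTat.eq_zero_of_notMem hls hi, zero_mul]
  have hplus : ∀ i ∈ Bplus φ g zs, d i = 0 := by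
    rintro i ⟨-, l', hl', hpos⟩
    have hsum : ∑ j, l' j * d j = 0 := by
      rw [KKTat.sum_mul_inner hl' hφ hg w, ← KKTat.sum_mul_inner hls hφ hg w]
      exact Finset.sum_eq_zero fun j _ => hlsd j
    have := (Finset.sum_eq_zero_iff_of_nonpos fun j _ => ?_).1 hsum i (Finset.mem_univ i)
    · exact (mul_eq_zero.1 this).resolve_left hpos.ne'
    · by_cases hj : j ∈ ActB g zs
      · exact mul_nonpos_of_nonneg_of_nonpos (hl'.2.2.1 j) (hdnonpos j hj)
      · simp [KKTat.eq_zero_of_notMem hl' hj]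
  have hmul : ∀ i, Tendsto (fun a => c a * ((l a i - ls i) * d i)) 𝒰 (𝓝 0) := fun i => by
    rcases hcases i with h | h
    · have h1 := (hrt i).mul_const (d i)
      rw [zero_mul] at h1
      refine h1.congr' (h.mono fun a ha => ?_)
      rw [ha, hlsz i h]; ring
    · have hi : i ∈ ActB g zs := by
        have h1 : Tendsto (fun a => -(g i (z a))) 𝒰 (𝓝 0) := (hr0 i).congr' h
        exact neg_eq_zero.1 (tendsto_nhds_unique (hgi i).neg h1)
      simp [hd0 i hi h]
  obtain ⟨σ, hσ, hsoc⟩ := hS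
  have hcurv := hsoc ls hls w hplus fun i hi => hdnonpos i hi.1
  rw [hw1, one_pow, mul_one, hessL_eq hφ hg] at hcurv
  have hgrad0 : Tendsto (fun a => ⟪w, c a • gradL φ g (l a) (z a)⟫) 𝒰 (𝓝 0) := by
    have h1 : Tendsto (fun a => c a • gradL φ g (l a) (z a)) 𝒰 (𝓝 0) := by
      refine squeeze_zero_norm' (hcpos.mono fun a ha => ?_) ho
      rw [norm_smul, Real.norm_eq_abs, abs_of_pos ha]
      exact mul_le_mul_of_nonneg_left (norm_gradL_le_eta _ _) ha.le
    simpa using (tendsto_const_nhds (x := w)).inner h1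
  have hgradH : Tendsto (fun a => ⟪w, c a • gradL φ g (l a) (z a)⟫) 𝒰
      (𝓝 (⟪w, (fderiv ℝ (gradient φ) zs +
        ∑ i, ls i • fderiv ℝ (gradient (g i)) zs) w⟫ + ∑ _i : Fin m, 0)) := by
    have h1 : Tendsto (fun a => c a • (gradient φ (z a) - gradient φ zs) +
        ∑ i, l a i • (c a • (gradient (g i) (z a) - gradient (g i) zs))) 𝒰
        (𝓝 ((fderiv ℝ (gradient φ) zs + ∑ i, ls i • fderiv ℝ (gradient (g i)) zs) w)) := by
      simp only [add_apply, sum_apply, smul_apply]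
      exact (hφ.differentiableAt_gradient.hasFDerivAt.tendsto_quotient hz hw).add
        (tendsto_finsetSum _ fun i _ => (hli i).smul
          ((hg i).differentiableAt_gradient.hasFDerivAt.tendsto_quotient hz hw))
    refine (((tendsto_const_nhds (x := w)).inner h1).add
      (tendsto_finsetSum _ fun i _ => hmul i)).congr' ?_
    filter_upwards [hz.eventually (eventually_gradL_eq hφ hg)] with a ha
    have hsplit : c a • gradL φ g (l a) (z a) =
        (c a • (gradient φ (z a) - gradient φ zs) +
          ∑ i, l a i • (c a • (gradient (g i) (z a) - gradient (g i) zs))) +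
        ∑ i, (c a * (l a i - ls i)) • gradient (g i) zs := by
      have h0 := hls.1
      rw [(eventually_gradL_eq hφ hg).self_of_nhds ls] at h0
      rw [ha, eq_neg_of_add_eq_zero_left h0]
      simp only [smul_sub, smul_add, sub_smul, mul_sub, mul_smul, Finset.sum_sub_distrib,
        Finset.smul_sum, smul_neg, smul_comm (c a)]
      abel
    rw [hsplit, inner_add_right w (_ + _), _root_.inner_sum]
    congr 1
    refine Finset.sum_congr rfl fun i _ => ?_
    rw [real_inner_smul_right, real_inner_comm, mul_assoc]
  have := tendsto_nhds_unique hgradH hgrad0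
  simp only [Finset.sum_const_zero, add_zero] at this
  linarith

/-- Error bound for the primal variable: the distance to the solution is controlled by the KKT
residual. -/
lemma sub_isBigO_eta (hφ : ContDiffAt ℝ 2 φ zs) (hg : ∀ i, ContDiffAt ℝ 2 (g i) zs)
    (hS : SOC φ g zs) (hz : Tendsto z 𝒰 (𝓝 zs)) (hl : Tendsto l 𝒰 (𝓝 ls))
    (hls : ls ∈ Slam φ g zs) :
    (fun a => z a - zs) =O[𝒰] fun a => eta φ g (z a) (l a) := by
  by_contra hO
  have hlt : ∀ C : ℝ, ∀ᶠ a in 𝒰, C * eta φ g (z a) (l a) < ‖z a - zs‖ := fun C => by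
    have h1 : ¬ ∀ᶠ a in 𝒰, ‖z a - zs‖ ≤ C * ‖eta φ g (z a) (l a)‖ := fun h =>
      hO (Asymptotics.IsBigO.of_bound C h)
    refine (Ultrafilter.eventually_not.2 h1).mono fun a ha => ?_
    rwa [not_le, Real.norm_of_nonneg (eta_nonneg _ _)] at ha
  have hpos : ∀ᶠ a in 𝒰, 0 < ‖z a - zs‖ := (hlt 0).mono fun a ha => by simpa using ha
  refine not_eta_isLittleO hφ hg hS hz hl hls
    (hpos.mono fun a ha => sub_ne_zero.1 (norm_pos_iff.1 ha)) ?_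
  rw [Metric.tendsto_nhds]
  intro ε hε
  filter_upwards [hpos, hlt ε⁻¹] with a ha hb
  rw [Real.dist_eq, sub_zero, abs_of_nonneg (mul_nonneg (inv_nonneg.2 ha.le) (eta_nonneg _ _)),
    inv_mul_lt_iff₀ ha, mul_comm]
  rwa [inv_mul_lt_iff₀ hε] at hb

lemma eventually_Aest_eq (hφ : ContDiffAt ℝ 2 φ zs) (hg : ∀ i, ContDiffAt ℝ 2 (g i) zs)
    (hS : SOC φ g zs) (hz : Tendsto z 𝒰 (𝓝 zs)) (hl : Tendsto l 𝒰 (𝓝 ls))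
    (hls : ls ∈ Slam φ g zs) {τ : ℝ} (hτ0 : 0 < τ) (hτ1 : τ < 1) :
    ∀ᶠ a in 𝒰, Aest φ g τ (z a) (l a) = ActB g zs := by
  have heta := tendsto_eta hφ hg hz hl hls
  have hpow : ∀ s : ℝ, 0 < s → Tendsto (fun a => eta φ g (z a) (l a) ^ s) 𝒰 (𝓝 0) :=
    fun s hs => by
      simpa [Real.zero_rpow hs.ne'] using heta.rpow_const (Or.inr hs.le)
  have hiff : ∀ i, ∀ᶠ a in 𝒰, i ∈ Aest φ g τ (z a) (l a) ↔ i ∈ ActB g zs := fun i => by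
    have hgi : Tendsto (fun a => g i (z a)) 𝒰 (𝓝 (g i zs)) := (hg i).continuousAt.tendsto.comp hz
    by_cases hi : i ∈ ActB g zs
    · have hi' : g i zs = 0 := hi
      have h1 : (fun a => g i (z a)) =O[𝒰] fun a => eta φ g (z a) (l a) := by
        have h2 := (((hg i).differentiableAt (by simp)).hasFDerivAt.isBigO_sub.comp_tendsto hz)
        simp only [Function.comp_def, hi', sub_zero] at h2
        exact h2.trans (sub_isBigO_eta hφ hg hS hz hl hls)
      obtain ⟨C, hCpos, hC⟩ := h1.exists_pos
      have hsmall : ∀ᶠ a in 𝒰, eta φ g (z a) (l a) ^ (1 - τ) < C⁻¹ :=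
        (hpow (1 - τ) (by linarith)).eventually (gt_mem_nhds (inv_pos.2 hCpos))
      filter_upwards [hC.bound, hsmall] with a ha hb
      refine iff_of_true ?_ hi
      have he := eta_nonneg (φ := φ) (g := g) (z a) (l a)
      rw [Real.norm_eq_abs, Real.norm_of_nonneg he] at ha
      have hsplit : eta φ g (z a) (l a) =
          eta φ g (z a) (l a) ^ (1 - τ) * eta φ g (z a) (l a) ^ τ := by
        rw [← Real.rpow_add_of_nonneg he (by linarith) hτ0.le, sub_add_cancel, Real.rpow_one]
      have hle : C * eta φ g (z a) (l a) ≤ eta φ g (z a) (l a) ^ τ := by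
        calc C * eta φ g (z a) (l a)
            = C * (eta φ g (z a) (l a) ^ (1 - τ) * eta φ g (z a) (l a) ^ τ) := by rw [← hsplit]
          _ ≤ C * (C⁻¹ * eta φ g (z a) (l a) ^ τ) := by gcongr
          _ = eta φ g (z a) (l a) ^ τ := by field_simp
      exact (abs_le.1 (ha.trans hle)).1
    · have hneg : g i zs < 0 := lt_of_le_of_ne (hls.2.1 i) hi
      have h1 : Tendsto (fun a => g i (z a) + eta φ g (z a) (l a) ^ τ) 𝒰 (𝓝 (g i zs)) := by
        simpa using hgi.add (hpow τ hτ0)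
      filter_upwards [h1.eventually (gt_mem_nhds hneg)] with a ha
      refine iff_of_false (fun h => ?_) hi
      have h2 : -(eta φ g (z a) (l a)) ^ τ ≤ g i (z a) := h
      linarith
  exact (eventually_all.2 hiff).mono fun a ha => Set.ext ha

end ErrorBound

lemma norm_sub_le_deltaP {n m : ℕ} {φ : En n → ℝ} {g : Fin m → En n → ℝ} {zs : En n}
    (z : En n) (l : En m) : ‖z - zs‖ ≤ deltaP φ g zs z l :=
  Real.le_sqrt_of_sq_le (le_add_of_nonneg_right (sq_nonneg _))

lemma infDist_le_deltaP {n m : ℕ} {φ : En n → ℝ} {g : Fin m → En n → ℝ} {zs : En n}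
    (z : En n) (l : En m) : infDist l (Slam φ g zs) ≤ deltaP φ g zs z l :=
  Real.le_sqrt_of_sq_le (le_add_of_nonneg_left (sq_nonneg _))

/-- Theorem 3.1: for (z,λ) close enough to S, the estimate A(z,λ) equals the active set B. -/
theorem stmt_2 {n m : ℕ} (φ : En n → ℝ) (g : Fin m → En n → ℝ) (zs : En n)
    (hA : AssumpA φ g zs) (τ : ℝ) (hτ0 : 0 < τ) (hτ1 : τ < 1) :
    ∃ δ : ℝ, 0 < δ ∧
      ∀ (z : En n) (l : En m), deltaP φ g zs z l ≤ δ →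
        Aest φ g τ z l = ActB g zs := by
  obtain ⟨hsmooth, ⟨l0, hl0⟩, hM, hS⟩ := hA
  obtain ⟨hφ, hg⟩ := hsmooth.contDiffAt
  have hK := isCompact_Slam hφ hg hM
  have hne : (Slam φ g zs).Nonempty := ⟨l0, hl0⟩
  have hev : ∀ᶠ p in comap (fun p : En n × En m => deltaP φ g zs p.1 p.2) (𝓝 0),
      Aest φ g τ p.1 p.2 = ActB g zs := by
    refine mem_iff_ultrafilter.2 fun 𝒰 h𝒰 => ?_
    have hδ : Tendsto (fun p : En n × En m => deltaP φ g zs p.1 p.2) 𝒰 (𝓝 0) :=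
      tendsto_iff_comap.2 h𝒰
    have hz : Tendsto (fun p : En n × En m => p.1) 𝒰 (𝓝 zs) := by
      rw [tendsto_iff_norm_sub_tendsto_zero]
      exact squeeze_zero (fun _ => norm_nonneg _)
        (fun p => norm_sub_le_deltaP p.1 p.2) hδ
    have hdist : Tendsto (fun p : En n × En m => infDist p.2 (Slam φ g zs)) 𝒰 (𝓝 0) :=
      squeeze_zero (fun _ => infDist_nonneg)
        (fun p => infDist_le_deltaP p.1 p.2) hδ
    choose proj hproj hproj_dist using fun l : En m => hK.exists_infDist_eq_dist hne l
    obtain ⟨ls, hls, hle⟩ := isCompact_iff_ultrafilter_le_nhds.1 hK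
      (𝒰.map fun p => proj p.2) (by
        rw [Ultrafilter.coe_map, le_principal_iff, mem_map]
        exact univ_mem' fun p => hproj p.2)
    have hpl : Tendsto (fun p : En n × En m => proj p.2) 𝒰 (𝓝 ls) := hle
    have hl : Tendsto (fun p : En n × En m => p.2) 𝒰 (𝓝 ls) := by
      refine (tendsto_iff_of_dist ?_).2 hpl
      exact hdist.congr fun p => hproj_dist p.2
    exact eventually_Aest_eq hφ hg hS hz hl hls hτ0 hτ1
  obtain ⟨ε, hε, hball⟩ := (nhds_basis_closedBall.comap _).eventually_iff.1 hev
  refine ⟨ε, hε, fun z l h => hball (x := (z, l)) ?_⟩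
  rw [mem_preimage, mem_closedBall_zero_iff]
  exact (Real.norm_of_nonneg (Real.sqrt_nonneg _)).trans_le h
end
end

section
/- Suppose Assumption A holds and τ ∈ (0,1). Then there are positive constants δ₀ and κ₂ such that whenever δ(z,λ) ≤ δ₀, any λ̃ feasible for LP(Â) (for any Â ⊆ A(z,λ)) satisfies δ(z,λ̃) ≤ κ₂ δ(z,λ)^τ. -/
open scoped RealInnerProductSpace
open Metric Set

noncomputable section

/-- Points whose coordinates have the same signs as `σ`, or vanish. -/
def signCone {m : ℕ} (σ : Fin m → SignType) : Set (En m) :=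
  {v | ∀ i, (σ i = 0 → v i = 0) ∧ 0 ≤ (σ i : ℝ) * v i}

lemma isClosed_signCone {m : ℕ} (σ : Fin m → SignType) : IsClosed (signCone σ) := by
  have h : signCone σ =
      ⋂ i, ({v : En m | σ i = 0 → v i = 0} ∩ {v : En m | 0 ≤ (σ i : ℝ) * v i}) := by
    ext v; simp [signCone]
  rw [h]
  refine isClosed_iInter fun i => IsClosed.inter ?_ ?_
  · by_cases hi : σ i = 0
    · simp only [hi, forall_const]
      exact isClosed_eq (by fun_prop) continuous_const
    · simp [hi]
  · exact isClosed_le continuous_const (by fun_prop)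

/-- A continuous linear map which is injective at the origin of a closed sign cone is bounded
below on it. -/
lemma exists_norm_le_of_signCone {m : ℕ} {F : Type*} [NormedAddCommGroup F] [NormedSpace ℝ F]
    (A : En m →L[ℝ] F) (σ : Fin m → SignType)
    (h : ∀ v ∈ signCone σ, A v = 0 → v = 0) :
    ∃ H : ℝ, ∀ v ∈ signCone σ, ‖v‖ ≤ H * ‖A v‖ := by
  have hcpt : IsCompact (sphere (0 : En m) 1 ∩ signCone σ) :=
    (isCompact_sphere _ _).inter_right (isClosed_signCone σ)
  rcases (sphere (0 : En m) 1 ∩ signCone σ).eq_empty_or_nonempty with he | hne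
  · refine ⟨0, fun v hv => ?_⟩
    by_contra hlt
    have hv0 : v ≠ 0 := by rintro rfl; simp at hlt
    have hn : 0 < ‖v‖ := norm_pos_iff.2 hv0
    have : ‖v‖⁻¹ • v ∈ sphere (0 : En m) 1 ∩ signCone σ := by
      refine ⟨by simp [norm_smul, hn.ne'], fun i => ⟨fun hi => by simp [(hv i).1 hi], ?_⟩⟩
      have := mul_nonneg (inv_nonneg.2 hn.le) (hv i).2
      simp only [PiLp.smul_apply, smul_eq_mul]
      linarith [mul_left_comm (σ i : ℝ) ‖v‖⁻¹ (v i)]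
    simp [he] at this
  · obtain ⟨u, hu, hmin⟩ := hcpt.exists_isMinOn hne (f := fun v => ‖A v‖) (by fun_prop)
    have hu1 : ‖u‖ = 1 := by simpa using hu.1
    have hpos : 0 < ‖A u‖ := by
      rw [norm_pos_iff]
      intro h0
      simp [h u hu.2 h0] at hu1
    refine ⟨‖A u‖⁻¹, fun v hv => ?_⟩
    rcases eq_or_ne v 0 with rfl | hv0
    · simp
    have hn : 0 < ‖v‖ := norm_pos_iff.2 hv0
    have hmem : ‖v‖⁻¹ • v ∈ sphere (0 : En m) 1 ∩ signCone σ := by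
      refine ⟨by simp [norm_smul, hn.ne'], fun i => ⟨fun hi => by simp [(hv i).1 hi], ?_⟩⟩
      have := mul_nonneg (inv_nonneg.2 hn.le) (hv i).2
      simp only [PiLp.smul_apply, smul_eq_mul]
      linarith [mul_left_comm (σ i : ℝ) ‖v‖⁻¹ (v i)]
    have h1 : ‖A u‖ ≤ ‖A (‖v‖⁻¹ • v)‖ := hmin hmem
    rw [map_smul, norm_smul, norm_inv, norm_norm] at h1
    rw [inv_mul_eq_div, le_div_iff₀ hpos]
    rwa [inv_mul_eq_div, le_div_iff₀ hn, mul_comm] at h1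

/-- Hoffman's error bound for the polyhedron `{x ≥ 0 | A x = b}`. -/
theorem hoffman_bound {m : ℕ} {F : Type*} [NormedAddCommGroup F] [NormedSpace ℝ F]
    (A : En m →L[ℝ] F) (b : F) (S : Set (En m))
    (hS : S = {x | (∀ i, 0 ≤ x i) ∧ A x = b}) (hcl : IsClosed S) (hne : S.Nonempty) :
    ∃ H : ℝ, 0 ≤ H ∧ ∀ x : En m, (∀ i, 0 ≤ x i) → infDist x S ≤ H * ‖A x - b‖ := by
  classical
  have hex : ∀ σ : Fin m → SignType, ∃ H : ℝ, (∀ v ∈ signCone σ, A v = 0 → v = 0) →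
      ∀ v ∈ signCone σ, ‖v‖ ≤ H * ‖A v‖ := fun σ => by
    by_cases h : ∀ v ∈ signCone σ, A v = 0 → v = 0
    · obtain ⟨H, hH⟩ := exists_norm_le_of_signCone A σ h
      exact ⟨H, fun _ => hH⟩
    · exact ⟨0, fun h' => absurd h' h⟩
  choose Hf hHf using hex
  refine ⟨∑ σ, |Hf σ|, Finset.sum_nonneg fun _ _ => abs_nonneg _, fun x hx => ?_⟩
  obtain ⟨p, hp, hpd⟩ := hcl.exists_infDist_eq_dist hne x
  have hp' := hp
  rw [hS] at hp'
  obtain ⟨hp0, hpA⟩ := hp'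
  set e := x - p with he
  have hei : ∀ i, e i = x i - p i := fun i => by simp [he]
  set σ : Fin m → SignType := fun i => SignType.sign (e i) with hσ
  have heσ : e ∈ signCone σ := fun i => by
    refine ⟨fun h => by simpa [hσ] using h, ?_⟩
    simp [hσ, sign_mul_self]
  have hker : ∀ v ∈ signCone σ, A v = 0 → v = 0 := by
    intro k hk hAk
    by_contra hk0
    -- Moving `p` along `k` stays in `S` and gets closer to `x`
    have hterm : ∀ i, 0 ≤ e i * k i := fun i => by
      have h1 := (hk i).2
      rcases lt_trichotomy (e i) 0 with h | h | h
      · simp [hσ, sign_neg h] at h1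
        exact mul_nonneg_of_nonpos_of_nonpos h.le h1
      · simp [h]
      · simp [hσ, sign_pos h] at h1
        exact mul_nonneg h.le h1
    have hin : 0 < ⟪e, k⟫ := by
      obtain ⟨j, hj⟩ : ∃ j, k j ≠ 0 := by
        by_contra! hall
        exact hk0 (by ext i; simpa using hall i)
      have hej : e j ≠ 0 := fun h => hj ((hk j).1 (by simp [hσ, h]))
      rw [PiLp.inner_apply]
      simp only [RCLike.inner_apply, conj_trivial]
      refine Finset.sum_pos' (fun i _ => by rw [mul_comm]; exact hterm i)
        ⟨j, Finset.mem_univ _, ?_⟩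
      rw [mul_comm]
      exact lt_of_le_of_ne (hterm j) (mul_ne_zero hej hj).symm
    have hev : ∀ᶠ t : ℝ in nhdsWithin 0 (Ioi 0),
        (∀ i, 0 ≤ p i + t * k i) ∧ t * ‖k‖ ^ 2 < 2 * ⟪e, k⟫ := by
      refine Filter.Eventually.and (Filter.eventually_all.2 fun i => ?_) ?_
      · rcases le_or_gt 0 (k i) with h | h
        · filter_upwards [self_mem_nhdsWithin] with t ht
          exact add_nonneg (hp0 i) (mul_nonneg (le_of_lt ht) h)
        · have hpi : 0 < p i := by
            have h1 := hterm i
            have h2 : e i ≠ 0 := fun h0 => h.ne ((hk i).1 (by simp [hσ, h0]))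
            have h3 : e i < 0 := by
              rcases lt_or_gt_of_ne h2 with h3 | h3
              · exact h3
              · nlinarith
            have := hei i
            linarith [hx i]
          have hc : ContinuousAt (fun t : ℝ => p i + t * k i) 0 := by fun_prop
          have := hc.eventually (lt_mem_nhds (a := 0) (by simpa using hpi))
          exact (this.filter_mono nhdsWithin_le_nhds).mono fun t ht => le_of_lt ht
      · have hc : ContinuousAt (fun t : ℝ => t * ‖k‖ ^ 2) 0 := by fun_prop
        have := hc.eventually (gt_mem_nhds (a := 2 * ⟪e, k⟫) (by simpa using hin))
        exact this.filter_mono nhdsWithin_le_nhds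
    obtain ⟨t, ⟨ht1, ht2⟩, ht0⟩ := (hev.and self_mem_nhdsWithin).exists
    have ht0 : 0 < t := ht0
    have hq : p + t • k ∈ S := by
      rw [hS]
      exact ⟨fun i => by simpa using ht1 i, by simp [hAk, hpA]⟩
    have hle : ‖e‖ ≤ ‖e - t • k‖ := by
      have h1 := infDist_le_dist_of_mem (x := x) hq
      rw [hpd, dist_eq_norm, dist_eq_norm] at h1
      have h2 : e - t • k = x - (p + t • k) := by rw [he]; abel
      rwa [h2]
    have hsq := pow_le_pow_left₀ (norm_nonneg _) hle 2
    rw [norm_sub_sq_real e (t • k), inner_smul_right, norm_smul, mul_pow, Real.norm_eq_abs, sq_abs] at hsq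
    nlinarith
  have hmain := hHf σ hker e heσ
  have hAe : A e = A x - b := by rw [he, map_sub, hpA]
  rw [hpd, dist_eq_norm, ← hAe]
  refine hmain.trans (mul_le_mul_of_nonneg_right ((le_abs_self _).trans ?_) (norm_nonneg _))
  exact Finset.single_le_sum (f := fun σ => |Hf σ|) (fun _ _ => abs_nonneg _) (Finset.mem_univ σ)

lemma ContDiffAt.gradient_one {n : ℕ} {f : En n → ℝ} {x : En n} (h : ContDiffAt ℝ 2 f x) :
    ContDiffAt ℝ 1 (gradient f) x := by
  have h1 : ContDiffAt ℝ 1 (fderiv ℝ f) x := h.fderiv_right (by norm_num)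
  exact ((InnerProductSpace.toDual ℝ (En n)).symm.contDiff.contDiffAt).comp x h1

lemma ContDiffAt.eventually_norm_sub_le {n : ℕ} {F : Type*} [NormedAddCommGroup F]
    [NormedSpace ℝ F] {f : En n → F} {x : En n} (h : ContDiffAt ℝ 1 f x) :
    ∃ K : ℝ, ∀ᶠ z in nhds x, ‖f z - f x‖ ≤ K * ‖z - x‖ := by
  obtain ⟨K, t, ht, hK⟩ := h.exists_lipschitzOnWith
  refine ⟨K, ?_⟩
  filter_upwards [ht] with z hz
  exact hK.norm_sub_le hz (mem_of_mem_nhds ht)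

lemma gradL_eq {n m : ℕ} {φ : En n → ℝ} {g : Fin m → En n → ℝ} {z : En n}
    (hφ : DifferentiableAt ℝ φ z) (hg : ∀ i, DifferentiableAt ℝ (g i) z) (l : En m) :
    gradL φ g l z = gradient φ z + ∑ i, l i • gradient (g i) z := by
  have h : HasFDerivAt (fun z' => Lagr φ g z' l)
      (fderiv ℝ φ z + ∑ i, l i • fderiv ℝ (g i) z) z := by
    unfold Lagr
    refine hφ.hasFDerivAt.add (HasFDerivAt.fun_sum fun i _ => ?_)
    exact (hg i).hasFDerivAt.const_mul (l i)
  simp [gradL, gradient, h.fderiv]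

lemma norm_le_card_mul {n : ℕ} (v : En n) {R : ℝ} (h : ∀ j, |v j| ≤ R) : ‖v‖ ≤ n * R := by
  calc ‖v‖ = ‖∑ j, EuclideanSpace.single j (v j)‖ := by
        congr 1; ext i; simp [Finset.sum_apply, Pi.single_apply]
    _ ≤ ∑ j, ‖EuclideanSpace.single j (v j)‖ := norm_sum_le _ _
    _ ≤ ∑ _j : Fin n, R := Finset.sum_le_sum fun j _ => by simpa using h j
    _ = n * R := by simp

lemma eta_le {n m : ℕ} (φ : En n → ℝ) (g : Fin m → En n → ℝ) (z : En n) (l : En m) {a b : ℝ}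
    (ha : ‖gradL φ g l z‖ ≤ a) (hb : ∀ i, |min (l i) (-(g i z))| ≤ b) :
    eta φ g z l ≤ a + m * b := by
  have hN := norm_le_card_mul (WithLp.toLp 2 fun i => min (l i) (-(g i z)) : En m) hb
  rw [EuclideanSpace.norm_eq] at hN
  simp only [Real.norm_eq_abs, sq_abs] at hN
  have h0 : 0 ≤ ∑ i, (min (l i) (-(g i z))) ^ 2 := Finset.sum_nonneg fun _ _ => sq_nonneg _
  have h1 := Real.sqrt_nonneg (∑ i, (min (l i) (-(g i z))) ^ 2)
  have h2 := Real.sq_sqrt h0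
  unfold eta
  calc _ ≤ ‖gradL φ g l z‖ + √(∑ i, (min (l i) (-(g i z))) ^ 2) := by
        apply Real.sqrt_le_iff.2
        constructor
        · positivity
        · nlinarith [mul_nonneg (norm_nonneg (gradL φ g l z)) h1]
    _ ≤ _ := add_le_add ha hN

/-- Multipliers with bounded dual residual are bounded under a Slater-type direction `y`. -/
lemma sum_multipliers_le {n m : ℕ} {V : En n} {W : Fin m → En n} {y : En n} {c R : ℝ} {l : En m}
    (hl : ∀ i, 0 ≤ l i) (hW : ∀ i, l i ≠ 0 → ⟪W i, y⟫ ≤ -c)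
    (hR : ‖V + ∑ i, l i • W i‖ ≤ R) :
    c * ∑ i, l i ≤ (‖V‖ + R) * ‖y‖ := by
  have h1 : c * ∑ i, l i ≤ -∑ i, l i * ⟪W i, y⟫ := by
    rw [Finset.mul_sum, ← Finset.sum_neg_distrib]
    refine Finset.sum_le_sum fun i _ => ?_
    rcases eq_or_ne (l i) 0 with h | h
    · simp [h]
    · nlinarith [hW i h, hl i]
  have h2 : ⟪V + ∑ i, l i • W i, y⟫ = ⟪V, y⟫ + ∑ i, l i * ⟪W i, y⟫ := by
    simp [inner_add_left, sum_inner, inner_smul_left]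
  have h3 := neg_le_of_abs_le (abs_real_inner_le_norm (V + ∑ i, l i • W i) y)
  have h4 := real_inner_le_norm V y
  have h5 := mul_le_mul_of_nonneg_right hR (norm_nonneg y)
  linarith

lemma sum_apply_smul_sub_le {n m : ℕ} (V V' : En n) (W W' : Fin m → En n) (l : En m) {M d : ℝ}
    (hV : ‖V - V'‖ ≤ d) (hW : ∀ i, ‖W i - W' i‖ ≤ d) (hl : ∀ i, |l i| ≤ M) :
    ‖(V + ∑ i, l i • W i) - (V' + ∑ i, l i • W' i)‖ ≤ (1 + m * M) * d := by
  have h : (V + ∑ i, l i • W i) - (V' + ∑ i, l i • W' i)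
      = (V - V') + ∑ i, l i • (W i - W' i) := by
    simp only [smul_sub, Finset.sum_sub_distrib]; abel
  rw [h]
  calc _ ≤ ‖V - V'‖ + ∑ i, ‖l i • (W i - W' i)‖ :=
        (norm_add_le _ _).trans (by gcongr; exact norm_sum_le _ _)
    _ ≤ d + ∑ _i : Fin m, M * d := by
        refine add_le_add hV (Finset.sum_le_sum fun i _ => ?_)
        rw [norm_smul]
        exact mul_le_mul (hl i) (hW i) (norm_nonneg _) ((abs_nonneg _).trans (hl i))
    _ = _ := by simp; ring

lemma Slam_eq {n m : ℕ} {φ : En n → ℝ} {g : Fin m → En n → ℝ} {zs : En n}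
    (hφ : DifferentiableAt ℝ φ zs) (hg : ∀ i, DifferentiableAt ℝ (g i) zs)
    (hfeas : ∀ i, g i zs ≤ 0) :
    Slam φ g zs = {x : En m | (∀ i, 0 ≤ x i) ∧
      (∑ i, x i • gradient (g i) zs, ∑ i, x i * g i zs) = (-gradient φ zs, (0 : ℝ))} := by
  ext x
  simp only [Slam, KKTat, mem_ofPred_eq, gradL_eq hφ hg, Prod.mk.injEq, eq_neg_iff_add_eq_zero,
    add_comm (gradient φ zs)]
  tauto

lemma multiplier_eq_zero {n m : ℕ} {φ : En n → ℝ} {g : Fin m → En n → ℝ} {zs : En n} {l : En m}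
    (h : KKTat φ g zs l) (i : Fin m) (hi : g i zs ≠ 0) : l i = 0 := by
  have h0 : ∀ j ∈ Finset.univ, l j * g j zs ≤ 0 := fun j _ =>
    mul_nonpos_of_nonneg_of_nonpos (h.2.2.1 j) (h.2.1 j)
  have := (Finset.sum_eq_zero_iff_of_nonpos h0).1 h.2.2.2 i (Finset.mem_univ i)
  exact (mul_eq_zero.1 this).resolve_right hi

/-- First-order Lipschitz estimates at `zs` with a common constant. -/
lemma exists_common_lipschitz {n m : ℕ} {φ : En n → ℝ} {g : Fin m → En n → ℝ} {zs : En n}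
    (hφ : ContDiffAt ℝ 2 φ zs) (hg : ∀ i, ContDiffAt ℝ 2 (g i) zs) :
    ∃ K : ℝ, 0 ≤ K ∧ ∀ᶠ z in nhds zs, ‖gradient φ z - gradient φ zs‖ ≤ K * ‖z - zs‖ ∧
      (∀ i, ‖gradient (g i) z - gradient (g i) zs‖ ≤ K * ‖z - zs‖) ∧
      ∀ i, |g i z - g i zs| ≤ K * ‖z - zs‖ := by
  obtain ⟨K0, h0⟩ := hφ.gradient_one.eventually_norm_sub_le
  choose K1 h1 using fun i => (hg i).gradient_one.eventually_norm_sub_le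
  choose K2 h2 using fun i => ((hg i).of_le (m := 1) (by norm_num)).eventually_norm_sub_le
  have hs1 : ∀ i, |K1 i| ≤ ∑ i, |K1 i| := fun i =>
    Finset.single_le_sum (f := fun i => |K1 i|) (fun _ _ => abs_nonneg _) (Finset.mem_univ i)
  have hs2 : ∀ i, |K2 i| ≤ ∑ i, |K2 i| := fun i =>
    Finset.single_le_sum (f := fun i => |K2 i|) (fun _ _ => abs_nonneg _) (Finset.mem_univ i)
  have hp1 : 0 ≤ ∑ i, |K1 i| := Finset.sum_nonneg fun _ _ => abs_nonneg _
  have hp2 : 0 ≤ ∑ i, |K2 i| := Finset.sum_nonneg fun _ _ => abs_nonneg _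
  refine ⟨|K0| + ∑ i, |K1 i| + ∑ i, |K2 i|, by positivity, ?_⟩
  filter_upwards [h0, Filter.eventually_all.2 h1, Filter.eventually_all.2 h2] with z a b c
  refine ⟨a.trans ?_, fun i => (b i).trans ?_, fun i => (c i).trans ?_⟩
  · gcongr; linarith [le_abs_self K0]
  · gcongr; linarith [le_abs_self (K1 i), hs1 i, abs_nonneg K0]
  · gcongr; linarith [le_abs_self (K2 i), hs2 i, abs_nonneg K0]

/-- Near `zs`, nonnegative multipliers supported on the active set with dual residual at most `R`
are uniformly bounded. -/
lemma exists_multiplier_bound {n m : ℕ} {φ : En n → ℝ} {g : Fin m → En n → ℝ} {zs : En n}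
    (hφ : ContDiffAt ℝ 2 φ zs) (hg : ∀ i, ContDiffAt ℝ 2 (g i) zs) (hM : MFCQ g zs)
    {R : ℝ} (hR : 0 ≤ R) :
    ∃ M : ℝ, 0 ≤ M ∧ ∀ᶠ z in nhds zs, ∀ l : En m, (∀ i, 0 ≤ l i) →
      (∀ i, g i zs ≠ 0 → l i = 0) → ‖gradient φ z + ∑ i, l i • gradient (g i) z‖ ≤ R →
      ∀ i, |l i| ≤ M := by
  obtain ⟨y, hy⟩ := hM
  obtain ⟨c, hc, hc0⟩ : ∃ c : ℝ, (∀ i, g i zs = 0 → ⟪gradient (g i) zs, y⟫ < -c) ∧ 0 < c := by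
    have hev : ∀ᶠ c : ℝ in nhdsWithin 0 (Ioi 0),
        ∀ i, g i zs = 0 → ⟪gradient (g i) zs, y⟫ < -c := by
      refine Filter.eventually_all.2 fun i => ?_
      by_cases hi : g i zs = 0
      · have hca : ContinuousAt (fun c : ℝ => -c) 0 := by fun_prop
        have := hca.eventually (lt_mem_nhds (a := ⟪gradient (g i) zs, y⟫) (by simpa using hy i hi))
        exact (this.filter_mono nhdsWithin_le_nhds).mono fun c hc _ => hc
      · simp [hi]
    obtain ⟨c, h1, h2⟩ := (hev.and self_mem_nhdsWithin).exists
    exact ⟨c, h1, h2⟩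
  refine ⟨(‖gradient φ zs‖ + 1 + R) * ‖y‖ / c, by positivity, ?_⟩
  have hev1 : ∀ᶠ z in nhds zs, ∀ i, g i zs = 0 → ⟪gradient (g i) z, y⟫ < -c := by
    refine Filter.eventually_all.2 fun i => ?_
    by_cases hi : g i zs = 0
    · have hca : ContinuousAt (fun z => ⟪gradient (g i) z, y⟫) zs :=
        (hg i).gradient_one.continuousAt.inner continuousAt_const
      exact (hca.eventually (gt_mem_nhds (hc i hi))).mono fun z hz _ => hz
    · simp [hi]
  have hev2 : ∀ᶠ z in nhds zs, ‖gradient φ z‖ < ‖gradient φ zs‖ + 1 :=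
    hφ.gradient_one.continuousAt.norm.eventually (gt_mem_nhds (by linarith))
  filter_upwards [hev1, hev2] with z h1 h2 l hl hsupp hres i
  have h3 := sum_multipliers_le (c := c) hl
    (fun i hi => (h1 i (by by_contra h; exact hi (hsupp i h))).le) hres
  have h4 : l i ≤ ∑ i, l i :=
    Finset.single_le_sum (f := fun i => l i) (fun i _ => hl i) (Finset.mem_univ i)
  rw [abs_of_nonneg (hl i), le_div_iff₀ hc0]
  have h5 : (‖gradient φ z‖ + R) * ‖y‖ ≤ (‖gradient φ zs‖ + 1 + R) * ‖y‖ := by gcongr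
  nlinarith

/-- The residual `eta` is bounded by a multiple of any bound on the distance of `(z, l)` to a
primal-dual solution `(zs, p)`. -/
lemma eta_le_mul_of_kkt {n m : ℕ} {φ : En n → ℝ} {g : Fin m → En n → ℝ} {zs z : En n}
    {l p : En m} {K M G d : ℝ} (hK : 0 ≤ K) (hp : KKTat φ g zs p)
    (hφs : DifferentiableAt ℝ φ zs) (hgs : ∀ i, DifferentiableAt ℝ (g i) zs)
    (hφz : DifferentiableAt ℝ φ z) (hgz : ∀ i, DifferentiableAt ℝ (g i) z)
    (hφ : ‖gradient φ z - gradient φ zs‖ ≤ K * ‖z - zs‖)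
    (hg1 : ∀ i, ‖gradient (g i) z - gradient (g i) zs‖ ≤ K * ‖z - zs‖)
    (hg0 : ∀ i, |g i z - g i zs| ≤ K * ‖z - zs‖)
    (hM : ∀ i, |p i| ≤ M) (hG : ∀ i, ‖gradient (g i) zs‖ ≤ G)
    (hz : ‖z - zs‖ ≤ d) (hl : ‖l - p‖ ≤ d) (hd1 : d ≤ 1) :
    eta φ g z l ≤ ((1 + m * M) * K + m * (G + K) + m * (1 + K)) * d := by
  have hd0 : 0 ≤ d := (norm_nonneg _).trans hz
  have hli : ∀ i, |l i - p i| ≤ d := fun i => by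
    have := (PiLp.norm_apply_le (l - p) i).trans hl
    simpa using this
  have hKd : K * ‖z - zs‖ ≤ K * d := by gcongr
  have hgrad : ‖gradL φ g l z‖ ≤ (1 + m * M) * (K * d) + m * ((G + K) * d) := by
    have h0 : gradient φ zs + ∑ i, p i • gradient (g i) zs = 0 := by
      rw [← gradL_eq hφs hgs]; exact hp.1
    have h1 := sum_apply_smul_sub_le (gradient φ z) (gradient φ zs) (fun i => gradient (g i) z)
      (fun i => gradient (g i) zs) p (hφ.trans hKd) (fun i => (hg1 i).trans hKd) hM
    rw [h0, sub_zero] at h1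
    have h2 : gradL φ g l z = (gradient φ z + ∑ i, p i • gradient (g i) z)
        + ∑ i, (l i - p i) • gradient (g i) z := by
      rw [gradL_eq hφz hgz]
      simp only [sub_smul, Finset.sum_sub_distrib]; abel
    rw [h2]
    refine (norm_add_le _ _).trans (add_le_add h1 ((norm_sum_le _ _).trans ?_))
    calc _ ≤ ∑ _i : Fin m, (G + K) * d := by
          refine Finset.sum_le_sum fun i _ => ?_
          rw [norm_smul, mul_comm]
          refine mul_le_mul ?_ (hli i) (norm_nonneg _) ?_
          · have h3 := norm_le_insert' (gradient (g i) z) (gradient (g i) zs)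
            nlinarith [hg1 i, hG i]
          · linarith [(norm_nonneg _).trans (hG i)]
      _ = _ := by simp
  have hmin : ∀ i, |min (l i) (-(g i z))| ≤ (1 + K) * d := fun i => by
    have h1 : min (p i) (-(g i zs)) = 0 := by
      by_cases hi : g i zs = 0
      · simp [hi, hp.2.2.1 i]
      · rw [multiplier_eq_zero hp i hi]
        exact min_eq_left (by linarith [hp.2.1 i])
    have h2 := abs_min_sub_min_le_max (l i) (-(g i z)) (p i) (-(g i zs))
    rw [h1, sub_zero] at h2
    refine h2.trans (max_le ?_ ?_)
    · nlinarith [hli i]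
    · rw [neg_sub_neg, abs_sub_comm]
      nlinarith [hg0 i]
  refine (eta_le φ g z l hgrad hmin).trans (le_of_eq ?_)
  ring

/-- Error bound for the multiplier set at `zs`. -/
lemma exists_infDist_Slam_le {n m : ℕ} {φ : En n → ℝ} {g : Fin m → En n → ℝ} {zs : En n}
    (hφ : DifferentiableAt ℝ φ zs) (hg : ∀ i, DifferentiableAt ℝ (g i) zs)
    {l0 : En m} (hl0 : KKTat φ g zs l0) :
    IsClosed (Slam φ g zs) ∧ ∃ H : ℝ, 0 ≤ H ∧ ∀ x : En m, (∀ i, 0 ≤ x i) →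
      (∀ i, g i zs ≠ 0 → x i = 0) →
      infDist x (Slam φ g zs) ≤ H * ‖gradient φ zs + ∑ i, x i • gradient (g i) zs‖ := by
  have hS := Slam_eq hφ hg hl0.2.1
  let A : En m →L[ℝ] En n × ℝ :=
    (∑ i, (EuclideanSpace.proj i : En m →L[ℝ] ℝ).smulRight (gradient (g i) zs)).prod
      (∑ i, (EuclideanSpace.proj i : En m →L[ℝ] ℝ).smulRight (g i zs))
  have hA : ∀ x, A x = (∑ i, x i • gradient (g i) zs, ∑ i, x i * g i zs) := fun x => by
    simp [A]
  simp only [← hA] at hS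
  have hcl : IsClosed (Slam φ g zs) := by
    rw [hS, ofPred_and, ofPred_forall]
    refine IsClosed.inter (isClosed_iInter fun i => isClosed_le continuous_const ?_)
      (isClosed_eq A.continuous continuous_const)
    fun_prop
  obtain ⟨H, hH0, hH⟩ := hoffman_bound A _ _ hS hcl ⟨l0, hl0⟩
  refine ⟨hcl, H, hH0, fun x hx hsupp => (hH x hx).trans (le_of_eq ?_)⟩
  have h0 : ∑ i, x i * g i zs = 0 := Finset.sum_eq_zero fun i _ => by
    by_cases hi : g i zs = 0
    · simp [hi]
    · simp [hsupp i hi]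
  rw [hA, h0, Prod.mk_sub_mk, sub_neg_eq_add, sub_zero, Prod.norm_mk, norm_zero,
    max_eq_left (norm_nonneg _), add_comm]

/-- Inactive constraints stay bounded away from zero near `zs`. -/
lemma exists_eventually_inactive {n m : ℕ} {g : Fin m → En n → ℝ} {zs : En n}
    (hg : ∀ i, ContinuousAt (g i) zs) (hfeas : ∀ i, g i zs ≤ 0) :
    ∃ ε : ℝ, 0 < ε ∧ ∀ᶠ z in nhds zs, ∀ i, g i zs ≠ 0 → g i z < -ε := by
  have hev : ∀ᶠ c : ℝ in nhdsWithin 0 (Ioi 0), ∀ i, g i zs ≠ 0 → g i zs < -c := by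
    refine Filter.eventually_all.2 fun i => ?_
    by_cases hi : g i zs = 0
    · simp [hi]
    · have hca : ContinuousAt (fun c : ℝ => -c) 0 := by fun_prop
      have := hca.eventually (lt_mem_nhds (a := g i zs)
        (by simpa using lt_of_le_of_ne (hfeas i) hi))
      exact (this.filter_mono nhdsWithin_le_nhds).mono fun c hc _ => hc
  obtain ⟨ε, h1, h2⟩ := (hev.and self_mem_nhdsWithin).exists
  refine ⟨ε, h2, Filter.eventually_all.2 fun i => ?_⟩
  by_cases hi : g i zs = 0
  · simp [hi]
  · exact ((hg i).eventually (gt_mem_nhds (h1 i hi))).mono fun z hz _ => hz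

lemma exists_mul_rpow_le {C τ ε : ℝ} (hτ : 0 < τ) (hε : 0 < ε) :
    ∃ r : ℝ, 0 < r ∧ ∀ d, 0 ≤ d → d ≤ r → (C * d) ^ τ ≤ ε := by
  have hc : ContinuousAt (fun d : ℝ => (C * d) ^ τ) 0 := by
    have h1 : ContinuousAt (fun d : ℝ => C * d) 0 := by fun_prop
    exact h1.rpow_const (Or.inr hτ.le)
  have h := hc.eventually (gt_mem_nhds (a := ε) (by simpa [Real.zero_rpow hτ.ne'] using hε))
  obtain ⟨r, hr, h⟩ := Metric.eventually_nhds_iff.1 h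
  refine ⟨r / 2, by positivity, fun d h0 h1 => (h ?_).le⟩
  rw [Real.dist_eq, sub_zero, abs_of_nonneg h0]
  linarith

/-- Lemma 3.1: any point λ̃ feasible for LP(Â), for any Â ⊆ A(z,λ), satisfies
δ(z,λ̃) ≤ κ₂ δ(z,λ)^τ. -/
theorem stmt_3 {n m : ℕ} (φ : En n → ℝ) (g : Fin m → En n → ℝ) (zs : En n)
    (hA : AssumpA φ g zs) (τ : ℝ) (hτ0 : 0 < τ) (hτ1 : τ < 1) :
    ∃ δ₀ : ℝ, 0 < δ₀ ∧ ∃ κ₂ : ℝ, 0 < κ₂ ∧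
      ∀ (z : En n) (l : En m), deltaP φ g zs z l ≤ δ₀ →
        ∀ Ah : Set (Fin m), Ah ⊆ Aest φ g τ z l →
          ∀ lt : En m, LPFeasible φ g τ z l lt →
            deltaP φ g zs z lt ≤ κ₂ * (deltaP φ g zs z l) ^ τ := by
  obtain ⟨⟨U, hU, hφU, hgU, -⟩, ⟨l0, hl0⟩, hM, -⟩ := hA
  have hφc : ContDiffAt ℝ 2 φ zs := hφU.contDiffAt hU
  have hgc : ∀ i, ContDiffAt ℝ 2 (g i) zs := fun i => (hgU i).contDiffAt hU
  have hdiff : ∀ᶠ z in nhds zs, DifferentiableAt ℝ φ z ∧ ∀ i, DifferentiableAt ℝ (g i) z := by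
    filter_upwards [eventually_mem_nhds_iff.2 hU] with z hz
    exact ⟨(hφU.contDiffAt hz).differentiableAt (by norm_num),
      fun i => ((hgU i).contDiffAt hz).differentiableAt (by norm_num)⟩
  obtain ⟨hφs, hgs⟩ := hdiff.self_of_nhds
  obtain ⟨K, hK, hLip⟩ := exists_common_lipschitz hφc hgc
  obtain ⟨M, hM0, hbd⟩ := exists_multiplier_bound hφc hgc hM (R := n) (Nat.cast_nonneg n)
  obtain ⟨ε, hε, hin⟩ := exists_eventually_inactive (fun i => (hgc i).continuousAt) hl0.2.1
  obtain ⟨hcl, H, hH0, hH⟩ := exists_infDist_Slam_le hφs hgs hl0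
  set G : ℝ := ∑ i, ‖gradient (g i) zs‖ with hGdef
  have hG0 : 0 ≤ G := Finset.sum_nonneg fun _ _ => norm_nonneg _
  have hG : ∀ i, ‖gradient (g i) zs‖ ≤ G := fun i =>
    Finset.single_le_sum (f := fun i => ‖gradient (g i) zs‖) (fun _ _ => norm_nonneg _)
      (Finset.mem_univ i)
  set C : ℝ := (1 + m * M) * K + m * (G + K) + m * (1 + K) with hC
  have hC0 : 0 ≤ C := by positivity
  obtain ⟨r, hr, hball⟩ := Metric.eventually_nhds_iff.1 (hdiff.and (hLip.and (hbd.and hin)))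
  obtain ⟨r', hr', hpow⟩ := exists_mul_rpow_le (C := C) hτ0 (lt_min hε one_pos)
  refine ⟨min (min 1 (r / 2)) r', by positivity,
    1 + H * (n * C ^ τ + (1 + m * M) * K), by positivity, fun z l hδ _ _ lt hlt => ?_⟩
  set d := deltaP φ g zs z l with hd
  have hd0 : 0 ≤ d := Real.sqrt_nonneg _
  have hd1 : d ≤ 1 := hδ.trans ((min_le_left _ _).trans (min_le_left _ _))
  have hdr : d < r := by
    have := hδ.trans ((min_le_left _ _).trans (min_le_right _ _))
    linarith
  have hz : ‖z - zs‖ ≤ d :=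
    Real.le_sqrt_of_sq_le (by nlinarith [sq_nonneg (infDist l (Slam φ g zs))])
  have hld : infDist l (Slam φ g zs) ≤ d :=
    Real.le_sqrt_of_sq_le (by nlinarith [sq_nonneg ‖z - zs‖])
  obtain ⟨⟨hφz, hgz⟩, ⟨hL1, hL2, hL3⟩, hbz, hinz⟩ :=
    hball (y := z) (by rw [dist_eq_norm]; exact hz.trans_lt hdr)
  obtain ⟨p, hp, hpd⟩ := hcl.exists_infDist_eq_dist ⟨l0, hl0⟩ l
  have hp' : KKTat φ g zs p := hp
  have hpM : ∀ i, |p i| ≤ M := hbd.self_of_nhds p hp'.2.2.1 (multiplier_eq_zero hp') (by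
    rw [← gradL_eq hφs hgs, hp'.1, norm_zero]; positivity)
  have hη : eta φ g z l ≤ C * d :=
    eta_le_mul_of_kkt hK hp' hφs hgs hφz hgz hL1 hL2 hL3 hpM hG hz
      (by rw [← dist_eq_norm, ← hpd]; exact hld) hd1
  have hη0 : 0 ≤ eta φ g z l := Real.sqrt_nonneg _
  have hητ : eta φ g z l ^ τ ≤ (C * d) ^ τ := Real.rpow_le_rpow hη0 hη hτ0.le
  have hCd := hpow d hd0 (hδ.trans (min_le_right _ _))
  obtain ⟨hres, hnn, hzero⟩ := hlt
  have hnn' : ∀ i, 0 ≤ lt i := fun i => by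
    by_cases hi : i ∈ Aest φ g τ z l
    · exact hnn i hi
    · exact (hzero i hi).ge
  have hsupp : ∀ i, g i zs ≠ 0 → lt i = 0 := fun i hi => hzero i fun hmem => by
    have h1 : -(eta φ g z l) ^ τ ≤ g i z := hmem
    linarith [hinz i hi, min_le_left ε 1]
  have hresz := norm_le_card_mul _ fun j => (hres j).trans hητ
  have hltM := hbz lt hnn' hsupp (hresz.trans (by
    have := hCd.trans (min_le_right _ _)
    exact mul_le_of_le_one_right (Nat.cast_nonneg n) this))
  have hKd : K * ‖z - zs‖ ≤ K * d := by gcongr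
  have hdiffres := sum_apply_smul_sub_le (gradient φ zs) (gradient φ z)
    (fun i => gradient (g i) zs) (fun i => gradient (g i) z) lt
    (d := K * d) (by rw [norm_sub_rev]; exact hL1.trans hKd)
    (fun i => by rw [norm_sub_rev]; exact (hL2 i).trans hKd) hltM
  have hress := norm_le_insert' (gradient φ zs + ∑ i, lt i • gradient (g i) zs)
    (gradient φ z + ∑ i, lt i • gradient (g i) z)
  have hdτ : d ≤ d ^ τ := Real.self_le_rpow_of_le_one hd0 hd1 hτ1.le
  rw [Real.mul_rpow hC0 hd0] at hresz
  have hfin : infDist lt (Slam φ g zs) ≤ H * ((n * C ^ τ + (1 + m * M) * K) * d ^ τ) := by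
    refine (hH lt hnn' hsupp).trans (mul_le_mul_of_nonneg_left ?_ hH0)
    have h1 : (1 + m * M) * K * d ≤ (1 + m * M) * K * d ^ τ := by gcongr
    linarith
  have hsqrt : deltaP φ g zs z lt ≤ ‖z - zs‖ + infDist lt (Slam φ g zs) := by
    have h1 := norm_nonneg (z - zs)
    have h2 : 0 ≤ infDist lt (Slam φ g zs) := infDist_nonneg
    exact Real.sqrt_le_iff.2 ⟨by positivity, by nlinarith⟩
  linarith
end
end
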